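/- arXiv:math/0404319 — 2 statements merged into one kernel-verified Lean document; each statement's English description precedes it below -/
import Mathlib

section
/- For every countable simple graph G containing no infinite complete subgraph, there exists a countable rigid simple graph G' containing G as an induced subgraph (i.e., G is isomorphic to an induced subgraph of G'). -/
/-- A graph is `KOmegaFree` if it contains no infinite set of pairwise adjacent
vertices (no infinite complete subgraph). -/
def KOmegaFree {V : Type*} (G : SimpleGraph V) : Prop :=
  ¬ ∃ S : Set V, S.Infinite ∧ S.Pairwise G.Adj

namespace RigidExtension

/-- The join of the complete graph on `ℕ` with `G`. -/
def join {V : Type*} (G : SimpleGraph V) : SimpleGraph (ℕ ⊕ V) where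
  Adj
    | .inl i, .inl j => i ≠ j
    | .inr u, .inr v => G.Adj u v
    | _, _ => True
  symm := ⟨by
    rintro (i | u) (j | v) h
    · exact Ne.symm h
    · trivial
    · trivial
    · exact SimpleGraph.Adj.symm (G := G) h⟩
  loopless := ⟨by
    rintro (i | u) h
    · exact h rfl
    · exact G.loopless.irrefl u h⟩

/-- The vertices of `join G` that belong to the join of `G` with the complete graph on the first
`n` naturals. -/
def InLevel {V : Type*} (n : ℕ) : ℕ ⊕ V → Prop
  | .inl i => i < n
  | .inr _ => True

lemma InLevel.mono {V : Type*} {m n : ℕ} (h : m ≤ n) {a : ℕ ⊕ V} (ha : InLevel m a) :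
    InLevel n a := by
  cases a with
  | inl i => exact lt_of_lt_of_le ha h
  | inr v => trivial

lemma join_adj_inl {V : Type*} (G : SimpleGraph V) {n : ℕ} {a : ℕ ⊕ V} (ha : InLevel n a) :
    (join G).Adj (.inl n) a := by
  cases a with
  | inl i => exact (ne_of_lt ha).symm
  | inr v => trivial

/-- If `G` has no infinite clique, neither does its join with a finite complete graph. -/
lemma no_injective_clique {V : Type*} {G : SimpleGraph V} (hG : KOmegaFree G) (n : ℕ)
    (p : ℕ → ℕ ⊕ V) (hp : ∀ k, InLevel n (p k))
    (hadj : ∀ i j, i < j → (join G).Adj (p i) (p j)) : False := by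
  have hne : ∀ i j, i ≠ j → (join G).Adj (p i) (p j) := fun i j hij =>
    (lt_or_gt_of_ne hij).elim (hadj i j) fun h => (hadj j i h).symm
  have hinj : Function.Injective p := fun i j hij => by
    by_contra h
    exact (hne i j h).ne hij
  have hfin : ((Sum.inl '' Set.Iio n : Set (ℕ ⊕ V))).Finite := (Set.finite_Iio n).image _
  have hinf : (Set.range p \ Sum.inl '' Set.Iio n).Infinite :=
    (Set.infinite_range_of_injective hinj).sdiff hfin
  refine hG ⟨Sum.inr ⁻¹' Set.range p, ?_, ?_⟩
  · intro hS
    refine hinf ((hS.image Sum.inr).subset ?_)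
    rintro _ ⟨⟨k, rfl⟩, hk⟩
    have hpk := hp k
    cases h : p k with
    | inl i =>
      rw [h] at hk hpk
      exact (hk ⟨i, hpk, rfl⟩).elim
    | inr v => exact ⟨v, ⟨k, h⟩, rfl⟩
  · rintro u ⟨i, hi⟩ v ⟨j, hj⟩ huv
    have hij : i ≠ j := by
      rintro rfl
      exact huv (Sum.inr_injective (hi.symm.trans hj))
    have := hne i j hij
    rwa [hi, hj] at this

/-- There is no homomorphism from a level of `join G` to the previous one. -/
lemma no_hom_to_lower_level {V : Type*} {G : SimpleGraph V} (hG : KOmegaFree G) (n : ℕ)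
    (φ : ℕ ⊕ V → ℕ ⊕ V) (hφ : ∀ a, InLevel (n + 1) a → InLevel n (φ a))
    (hadj : ∀ a b, InLevel (n + 1) a → InLevel (n + 1) b → (join G).Adj a b →
      (join G).Adj (φ a) (φ b)) : False := by
  set p : ℕ → ℕ ⊕ V := fun k => φ^[k + 1] (.inl n) with hp
  have hsucc : ∀ k, p (k + 1) = φ (p k) := fun k => Function.iterate_succ_apply' φ (k + 1) _
  have hlevel : ∀ k, InLevel n (p k) := by
    intro k
    induction k with
    | zero => exact hφ _ (Nat.lt_succ_self n)
    | succ k ih =>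
      rw [hsucc]
      exact hφ _ (ih.mono n.le_succ)
  refine no_injective_clique hG n p hlevel ?_
  intro i
  induction i with
  | zero =>
    rintro (_ | j) hj
    · exact (lt_irrefl _ hj).elim
    · rw [hsucc]
      exact hadj _ _ (Nat.lt_succ_self n) ((hlevel j).mono n.le_succ) (join_adj_inl G (hlevel j))
  | succ i ih =>
    rintro (_ | j) hj
    · exact (Nat.not_lt_zero _ hj).elim
    · rw [hsucc, hsucc]
      exact hadj _ _ ((hlevel i).mono n.le_succ) ((hlevel j).mono n.le_succ)
        (ih j (Nat.lt_of_succ_lt_succ hj))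

/-- The neighbourhood of `z` receives homomorphisms from all levels of `join G`. -/
def IsRich {V W : Type*} (G : SimpleGraph V) (H : SimpleGraph W) (z : W) : Prop :=
  ∀ n, ∃ h : ℕ ⊕ V → W, (∀ a, InLevel n a → H.Adj z (h a)) ∧
    ∀ a b, InLevel n a → InLevel n b → (join G).Adj a b → H.Adj (h a) (h b)

/-- The neighbourhood of `z` maps homomorphically to some level of `join G`. -/
def IsPoor {V W : Type*} (G : SimpleGraph V) (H : SimpleGraph W) (z : W) : Prop :=
  ∃ n, ∃ c : W → ℕ ⊕ V, (∀ u, H.Adj z u → InLevel n (c u)) ∧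
    ∀ u v, H.Adj z u → H.Adj z v → H.Adj u v → (join G).Adj (c u) (c v)

lemma IsRich.map {V W : Type*} {G : SimpleGraph V} {H : SimpleGraph W} {z : W}
    (hz : IsRich G H z) (f : H →g H) : IsRich G H (f z) := fun n => by
  obtain ⟨h, h₁, h₂⟩ := hz n
  exact ⟨f ∘ h, fun a ha => f.map_adj (h₁ a ha), fun a b ha hb hab => f.map_adj (h₂ a b ha hb hab)⟩

lemma IsRich.not_isPoor {V W : Type*} {G : SimpleGraph V} (hG : KOmegaFree G)
    {H : SimpleGraph W} {z : W} (hz : IsRich G H z) : ¬ IsPoor G H z := by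
  rintro ⟨n, c, c₁, c₂⟩
  obtain ⟨h, h₁, h₂⟩ := hz (n + 1)
  exact no_hom_to_lower_level hG n (c ∘ h) (fun a ha => c₁ _ (h₁ a ha))
    fun a b ha hb hab => c₂ _ _ (h₁ a ha) (h₁ b hb) (h₂ a b ha hb hab)

/-- The edges of a rigid graph on nine vertices. -/
def coreEdges : List (Fin 9 × Fin 9) :=
  [(0, 4), (0, 6), (0, 7), (0, 8), (1, 5), (1, 6), (1, 7), (2, 3), (2, 5), (2, 7), (3, 5), (4, 5),
    (4, 8), (5, 8), (6, 7), (6, 8)]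

/-- Adjacency in a rigid graph on nine vertices. -/
def coreAdj (i j : Fin 9) : Bool :=
  coreEdges.contains (i, j) || coreEdges.contains (j, i)

lemma coreAdj_comm : ∀ i j, coreAdj i j = coreAdj j i := by decide +kernel

lemma coreAdj_irrefl : ∀ i, coreAdj i i = false := by decide +kernel

set_option synthInstance.maxHeartbeats 400000 in
set_option synthInstance.maxSize 2000 in
lemma core_rigid_aux : ∀ a₀ a₆, coreAdj a₀ a₆ → ∀ a₇, coreAdj a₀ a₇ → coreAdj a₆ a₇ →
    ∀ a₈, coreAdj a₀ a₈ → coreAdj a₆ a₈ → ∀ a₁, coreAdj a₁ a₆ → coreAdj a₁ a₇ →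
    ∀ a₅, coreAdj a₁ a₅ → coreAdj a₅ a₈ → ∀ a₄, coreAdj a₀ a₄ → coreAdj a₄ a₅ → coreAdj a₄ a₈ →
    ∀ a₂, coreAdj a₂ a₅ → coreAdj a₂ a₇ → ∀ a₃, coreAdj a₂ a₃ → coreAdj a₃ a₅ →
    a₀ = 0 ∧ a₁ = 1 ∧ a₂ = 2 ∧ a₃ = 3 ∧ a₄ = 4 ∧ a₅ = 5 ∧ a₆ = 6 ∧ a₇ = 7 ∧ a₈ = 8 := by
  decide +kernel

lemma core_rigid (g : Fin 9 → Fin 9) (hg : ∀ i j, coreAdj i j → coreAdj (g i) (g j)) (i : Fin 9) :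
    g i = i := by
  have h := core_rigid_aux (g 0) (g 6) (hg _ _ (by decide)) (g 7) (hg _ _ (by decide))
    (hg _ _ (by decide)) (g 8) (hg _ _ (by decide)) (hg _ _ (by decide)) (g 1)
    (hg _ _ (by decide)) (hg _ _ (by decide)) (g 5) (hg _ _ (by decide)) (hg _ _ (by decide))
    (g 4) (hg _ _ (by decide)) (hg _ _ (by decide)) (hg _ _ (by decide)) (g 2)
    (hg _ _ (by decide)) (hg _ _ (by decide)) (g 3) (hg _ _ (by decide)) (hg _ _ (by decide))
  obtain ⟨h0, h1, h2, h3, h4, h5, h6, h7, h8⟩ := h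
  fin_cases i <;> assumption

/-- The ray vertex `n` is attached to the core vertex `n % 3`; the vertex `0` of the ray is
moreover attached to the core vertex `3`. -/
def Attached (i : Fin 9) (n : ℕ) : Prop := i.val = n % 3 ∨ (n = 0 ∧ i.val = 3)

lemma Attached.lt_four {i : Fin 9} {n : ℕ} (h : Attached i n) : i.val < 4 := by
  unfold Attached at h
  omega

lemma not_coreAdj_of_lt : ∀ i j : Fin 9, i.val < 4 → j.val < 4 → coreAdj i j →
    (i.val = 2 ∧ j.val = 3) ∨ (i.val = 3 ∧ j.val = 2) := by decide +kernel

lemma not_coreAdj_zero_three : ∀ i : Fin 9, coreAdj i 0 → ¬ coreAdj i 3 := by decide +kernel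

/-- The index set of the blow-ups: each core vertex is joined to its own copy of the disjoint
union of the levels of `join G`. -/
abbrev BodyIndex (V : Type*) := Fin 9 × ℕ × (ℕ ⊕ V)

/-- The vertices of the rigid extension. -/
inductive Vertex (V : Type)
  | core (i : Fin 9)
  | ray (n : ℕ)
  | body (y : BodyIndex V)

instance {V : Type} [Countable V] : Countable (Vertex V) := by
  let t : Vertex V → Fin 9 ⊕ ℕ ⊕ BodyIndex V
    | .core i => .inl i
    | .ray n => .inr (.inl n)
    | .body y => .inr (.inr y)
  refine Function.Injective.countable (f := t) ?_
  rintro (i | n | y) (j | m | z) h <;> simp_all [t]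

/-- Adjacency inside the blow-ups. -/
def BodyAdj {V : Type} (G : SimpleGraph V) (y z : BodyIndex V) : Prop :=
  y.1 = z.1 ∧ y.2.1 = z.2.1 ∧ InLevel y.2.1 y.2.2 ∧ InLevel z.2.1 z.2.2 ∧
    (join G).Adj y.2.2 z.2.2

/-- Each vertex of a blow-up is attached to two ray vertices. -/
def Tagged {V : Type} (e : BodyIndex V → ℕ) (n : ℕ) (y : BodyIndex V) : Prop :=
  n = 30 * e y + y.1.val ∨ n = 30 * e y + y.1.val + 4

/-- The rigid extension of `G`. -/
def extension {V : Type} (G : SimpleGraph V) (e : BodyIndex V → ℕ) : SimpleGraph (Vertex V) where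
  Adj
    | .core i, .core j => coreAdj i j
    | .core i, .ray n => Attached i n
    | .ray n, .core i => Attached i n
    | .core i, .body y => i = y.1
    | .body y, .core i => i = y.1
    | .ray m, .ray n => m + 1 = n ∨ n + 1 = m
    | .ray n, .body y => Tagged e n y
    | .body y, .ray n => Tagged e n y
    | .body y, .body z => BodyAdj G y z
  symm := ⟨by
    rintro (i | n | y) (j | m | z) h
    · exact (coreAdj_comm j i).trans h
    · exact h
    · exact h
    · exact h
    · exact h.symm
    · exact h
    · exact h
    · exact h
    · exact ⟨h.1.symm, h.2.1.symm, h.2.2.2.1, h.2.2.1, h.2.2.2.2.symm⟩⟩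
  loopless := ⟨by
    rintro (i | n | y) h
    · simp [coreAdj_irrefl] at h
    · omega
    · exact h.2.2.2.2.ne rfl⟩

section

variable {V : Type} {G : SimpleGraph V} {e : BodyIndex V → ℕ}

lemma Tagged.eq (he : Function.Injective e) {n : ℕ} {y z : BodyIndex V} (hy : Tagged e n y)
    (hz : Tagged e n z) : y = z := by
  apply he
  unfold Tagged at hy hz
  omega

lemma isRich_core (i : Fin 9) : IsRich G (extension G e) (.core i) := fun n =>
  ⟨fun a => .body (i, n, a), fun _ _ => rfl, fun _ _ ha hb hab => ⟨rfl, rfl, ha, hb, hab⟩⟩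

lemma isPoor_ray (he : Function.Injective e) (n : ℕ) : IsPoor G (extension G e) (.ray n) := by
  refine ⟨3, fun
    | .core _ => .inl 1
    | .ray _ => .inl 2
    | .body _ => .inl 0, ?_, ?_⟩
  · rintro (i | m | y) - <;> simp [InLevel]
  · rintro (i | m | y) (j | k | z) hu hv huv
    · have hi : Attached i n := hu
      have hj : Attached j n := hv
      have := not_coreAdj_of_lt i j hi.lt_four hj.lt_four huv
      unfold Attached at hi hj
      omega
    · exact (by decide : (1 : ℕ) ≠ 2)
    · exact (by decide : (1 : ℕ) ≠ 0)
    · exact (by decide : (2 : ℕ) ≠ 1)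
    · have h₁ : n + 1 = m ∨ m + 1 = n := hu
      have h₂ : n + 1 = k ∨ k + 1 = n := hv
      have h₃ : m + 1 = k ∨ k + 1 = m := huv
      omega
    · exact (by decide : (2 : ℕ) ≠ 0)
    · exact (by decide : (0 : ℕ) ≠ 1)
    · exact (by decide : (0 : ℕ) ≠ 2)
    · obtain rfl := Tagged.eq he (n := n) hu hv
      exact (huv.ne rfl).elim

lemma isPoor_body (he : Function.Injective e) (y : BodyIndex V) :
    IsPoor G (extension G e) (.body y) := by
  have hlevel : ∀ z, (extension G e).Adj (.body y) (.body z) → InLevel y.2.1 z.2.2 := by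
    rintro z ⟨-, h, -, h', -⟩
    rwa [h]
  have hray : ∀ m z, (extension G e).Adj (.body y) (.ray m) →
      (extension G e).Adj (.body y) (.body z) → ¬ (extension G e).Adj (.ray m) (.body z) := by
    intro m z h₁ h₂ h₃
    obtain rfl := Tagged.eq he (n := m) h₁ h₃
    exact h₂.ne rfl
  refine ⟨y.2.1 + 2, fun
    | .core _ => .inl y.2.1
    | .ray _ => .inl (y.2.1 + 1)
    | .body z => z.2.2, ?_, ?_⟩
  · rintro (i | m | z) h
    · simp [InLevel]
    · simp [InLevel]
    · exact (hlevel z h).mono (by omega)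
  · rintro (i | m | z) (j | k | w) hu hv huv
    · obtain rfl : i = y.1 := hu
      obtain rfl : j = y.1 := hv
      exact (huv.ne rfl).elim
    · exact (Nat.lt_succ_self y.2.1).ne
    · exact join_adj_inl G (hlevel w hv)
    · exact (Nat.lt_succ_self y.2.1).ne'
    · have h₁ : Tagged e m y := hu
      have h₂ : Tagged e k y := hv
      have h₃ : m + 1 = k ∨ k + 1 = m := huv
      unfold Tagged at h₁ h₂
      omega
    · exact (hray m w hu hv huv).elim
    · exact (join_adj_inl G (hlevel z hu)).symm
    · exact (hray k z hv hu huv.symm).elim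
    · exact huv.2.2.2.2

lemma map_core (hG : KOmegaFree G) (he : Function.Injective e)
    (f : extension G e →g extension G e) (i : Fin 9) : f (.core i) = .core i := by
  have hcore : ∀ i, ∃ j, f (.core i) = .core j := by
    intro i
    have h := ((isRich_core (G := G) (e := e) i).map f).not_isPoor hG
    cases hf : f (.core i) with
    | core j => exact ⟨j, rfl⟩
    | ray n => exact (h (hf ▸ isPoor_ray he n)).elim
    | body y => exact (h (hf ▸ isPoor_body he y)).elim
  choose g hg using hcore
  rw [hg, core_rigid g ?_ i]
  intro i j hij
  have : (extension G e).Adj (f (.core i)) (f (.core j)) := f.map_adj hij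
  rwa [hg, hg] at this

lemma map_ray (hcore : ∀ f : extension G e →g extension G e, ∀ i, f (.core i) = .core i)
    (f : extension G e →g extension G e) (n : ℕ) : f (.ray n) = .ray n := by
  have hatt : ∀ i n, Attached i n → (extension G e).Adj (f (.ray n)) (.core i) := by
    intro i n h
    rw [← hcore f i]
    exact f.map_adj h
  induction n with
  | zero =>
    have h₀ := hatt 0 0 (Or.inl rfl)
    have h₃ := hatt 3 0 (Or.inr ⟨rfl, rfl⟩)
    cases hf : f (.ray 0) with
    | core j =>
      rw [hf] at h₀ h₃
      exact (not_coreAdj_zero_three j h₀ h₃).elim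
    | ray k =>
      rw [hf] at h₃
      obtain h | ⟨rfl, -⟩ : (3 : ℕ) = k % 3 ∨ _ := h₃
      · omega
      · rfl
    | body y =>
      rw [hf] at h₀ h₃
      have h₀' : (0 : Fin 9) = y.1 := h₀
      have h₃' : (3 : Fin 9) = y.1 := h₃
      exact absurd (h₀'.trans h₃'.symm) (by decide)
  | succ n ih =>
    have hlt : (n + 1) % 3 < 9 := by omega
    have h₁ := hatt ⟨(n + 1) % 3, hlt⟩ (n + 1) (Or.inl rfl)
    have h₂ : (extension G e).Adj (f (.ray n)) (f (.ray (n + 1))) :=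
      f.map_adj (Or.inl rfl : n + 1 = n + 1 ∨ _)
    rw [ih] at h₂
    cases hf : f (.ray (n + 1)) with
    | core j =>
      rw [hf] at h₁ h₂
      have hj : Attached j n := h₂
      have := not_coreAdj_of_lt j ⟨(n + 1) % 3, hlt⟩ hj.lt_four (by simp only; omega) h₁
      unfold Attached at hj
      simp only at this
      omega
    | ray k =>
      rw [hf] at h₁ h₂
      have h₁' : (n + 1) % 3 = k % 3 ∨ (k = 0 ∧ (n + 1) % 3 = 3) := h₁
      have h₂' : n + 1 = k ∨ k + 1 = n := h₂
      congr 1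
      omega
    | body y =>
      rw [hf] at h₁ h₂
      have h₁' : (n + 1) % 3 = y.1.val := congrArg Fin.val (h₁ : _ = y.1)
      have h₂' : Tagged e n y := h₂
      unfold Tagged at h₂'
      omega

lemma map_body (he : Function.Injective e) {f : extension G e →g extension G e}
    (hray : ∀ n, f (.ray n) = .ray n) (y : BodyIndex V) : f (.body y) = .body y := by
  have htag : ∀ n, Tagged e n y → (extension G e).Adj (f (.body y)) (.ray n) := by
    intro n h
    rw [← hray n]
    exact f.map_adj h
  have h₁ := htag _ (Or.inl rfl)
  have h₂ := htag _ (Or.inr rfl)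
  cases hf : f (.body y) with
  | core j =>
    rw [hf] at h₁ h₂
    have h₁' : Attached j _ := h₁
    have h₂' : Attached j _ := h₂
    unfold Attached at h₁' h₂'
    omega
  | ray k =>
    rw [hf] at h₁ h₂
    have h₁' : k + 1 = _ ∨ _ + 1 = k := h₁
    have h₂' : k + 1 = _ ∨ _ + 1 = k := h₂
    omega
  | body z =>
    rw [hf] at h₁
    rw [Tagged.eq he (Or.inl rfl : Tagged e _ y) h₁]

end

end RigidExtension

open RigidExtension in
/-- Every countable graph with no infinite complete subgraph embeds as an
induced subgraph into a countable rigid graph. -/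
theorem exists_rigid_countable_extension {V : Type} [Countable V]
    (G : SimpleGraph V) (hG : KOmegaFree G) :
    ∃ (W : Type) (_ : Countable W) (G' : SimpleGraph W),
      (∀ f : G' →g G', ∀ x, f x = x) ∧ Nonempty (G ↪g G') := by
  obtain ⟨e, he⟩ := exists_injective_nat (BodyIndex V)
  refine ⟨Vertex V, inferInstance, extension G e, ?_, ⟨⟨⟨fun v => .body (0, 0, .inr v), ?_⟩, ?_⟩⟩⟩
  · intro f x
    have hray := map_ray (map_core hG he) f
    cases x with
    | core i => exact map_core hG he f i
    | ray n => exact hray n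
    | body y => exact map_body he hray y
  · intro u v h
    simpa using h
  · intro u v
    exact ⟨fun h => h.2.2.2.2, fun h => ⟨rfl, rfl, trivial, trivial, h⟩⟩
end

section
/- Let H be a countable simple graph on vertex set ℕ that is H-connected and has no finite core. Then for every countable ordinal α there is no homomorphism H → H^{<α>}; consequently (since H^{<α>} ≤ H always holds) H^{<α>} < H, i.e., H^{<α>} belongs to the class GRA_H of graphs strictly below H. -/
/-- Finite strictly decreasing sequences of ordinals `< α` (including the
empty sequence). -/
def DecSeq (α : Ordinal) : Type _ :=
  {l : List Ordinal // l.Chain' (· > ·) ∧ ∀ x ∈ l, x < α}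

/-- The graph `H^{<α>}` for a graph `H` on `ℕ`: vertices are finite strictly
decreasing sequences of ordinals `< α`; `ν` and `μ` are adjacent iff one is a
proper initial segment of the other and their lengths are adjacent in `H`. -/
def GTree (H : SimpleGraph ℕ) (α : Ordinal) : SimpleGraph (DecSeq α) :=
  SimpleGraph.fromRel (fun ν μ => ν.1 <+: μ.1 ∧ H.Adj ν.1.length μ.1.length)

/-- Two graphs are hom-equivalent if there are homomorphisms both ways. -/
def HomEquiv {V : Type*} {W : Type*} (G : SimpleGraph V) (H : SimpleGraph W) : Prop :=
  Nonempty (G →g H) ∧ Nonempty (H →g G)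

/-- `X` is separated by `C` in `F`: for any two distinct `x, y ∈ X` there is
no walk from `x` to `y` all of whose vertices, other than `x` and `y`
themselves, avoid `C`. -/
def Separates {V : Type*} (F : SimpleGraph V) (X C : Set V) : Prop :=
  ∀ x ∈ X, ∀ y ∈ X, x ≠ y →
    ¬ ∃ p : F.Walk x y, ∀ v ∈ p.support, v ∉ C ∨ v = x ∨ v = y

/-- `F` is `H`-connected: no infinite set `X` of vertices of `F` is separated
by a set `C` whose induced subgraph is hom-equivalent to a finite subgraph
of `H`. -/
def HConnected {W : Type*} {V : Type*} (H : SimpleGraph W) (F : SimpleGraph V) : Prop :=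
  ¬ ∃ (X C : Set V), X.Infinite ∧ Separates F X C ∧
      ∃ H' : H.Subgraph, H'.verts.Finite ∧ HomEquiv (F.induce C) H'.coe

/-- `H` has a finite core if it is hom-equivalent to a finite subgraph of
itself. -/
def HasFiniteCore {W : Type*} (H : SimpleGraph W) : Prop :=
  ∃ H' : H.Subgraph, H'.verts.Finite ∧ HomEquiv H H'.coe

/-- A family of strictly decreasing lists over a well-founded order in which every list has only
finitely many one-step extensions by prefixes of members of the family is finite. -/
theorem List.finite_of_finite_extensions {β : Type*} [Preorder β] [WellFoundedLT β]
    (Y : Set (List β)) (hY : ∀ y ∈ Y, y.IsChain (· > ·))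
    (hfin : ∀ ν : List β, {b | ∃ y ∈ Y, ν ++ [b] <+: y}.Finite) : Y.Finite := by
  have cover : ∀ ν : List β, {y ∈ Y | ν <+: y} ⊆
      {ν} ∪ ⋃ b ∈ {b | ∃ y ∈ Y, ν ++ [b] <+: y}, {y ∈ Y | ν ++ [b] <+: y} := by
    rintro ν y ⟨hy, t, rfl⟩
    cases t with
    | nil => left; simp
    | cons b t =>
      right
      have hpre : ν ++ [b] <+: ν ++ b :: t := ⟨t, by simp⟩
      exact Set.mem_biUnion (show b ∈ {b | ∃ y ∈ Y, ν ++ [b] <+: y} from ⟨_, hy, hpre⟩) ⟨hy, hpre⟩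
  have step : ∀ b : β, ∀ ν : List β, {y ∈ Y | ν ++ [b] <+: y}.Finite := by
    intro b
    induction b using WellFoundedLT.induction with
    | ind b ih =>
      intro ν
      refine Set.Finite.subset ((Set.finite_singleton _).union
        ((hfin (ν ++ [b])).biUnion fun c hc => ih c ?_ _)) (cover _)
      obtain ⟨y, hy, t, rfl⟩ := hc
      have := hY _ hy
      simp only [List.append_assoc, List.cons_append, List.nil_append] at this
      have h2 := (List.isChain_append.1 this).2.1
      exact (List.isChain_cons_cons.1 h2).1
  refine Set.Finite.subset ((Set.finite_singleton _).union
    ((hfin []).biUnion fun c _ => step c _)) (Set.Subset.trans ?_ (cover []))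
  exact fun y hy => ⟨hy, y, rfl⟩

/-- A set of strictly decreasing lists over a well-founded order which is a chain for the
prefix relation is finite. -/
theorem List.finite_of_pairwise_comparable {β : Type*} [Preorder β] [WellFoundedLT β]
    (Y : Set (List β)) (hY : ∀ y ∈ Y, y.IsChain (· > ·))
    (hcomp : ∀ y ∈ Y, ∀ z ∈ Y, y <+: z ∨ z <+: y) : Y.Finite := by
  refine List.finite_of_finite_extensions Y hY fun ν => Set.Subsingleton.finite ?_
  have key : ∀ b c : β, ∀ y : List β, ν ++ [b] <+: y → ν ++ [c] <+: y → b = c := by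
    intro b c y hb hc
    have h := List.prefix_of_prefix_length_le hb hc (by simp)
    simpa using h.eq_of_length (by simp)
  rintro b ⟨y, hy, hb⟩ c ⟨z, hz, hc⟩
  rcases hcomp y hy z hz with h | h
  · exact key b c z (hb.trans h) hc
  · exact key b c y hb (hc.trans h)

/-- Among finitely many sequences of strictly decreasing lists over a well-founded order, each
with pairwise distinct lengths, there are two positions at which no two of the sequences have
comparable terms. -/
theorem List.exists_lt_incomparable {ι β : Type*} [Preorder β] [WellFoundedLT β]
    {S : Set ι} (hS : S.Finite) (y : ι → ℕ → List β)
    (hy : ∀ s ∈ S, ∀ k, (y s k).IsChain (· > ·))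
    (hinj : ∀ s ∈ S, Function.Injective fun k => (y s k).length) :
    ∃ k l, k < l ∧ ∀ v ∈ S, ∀ w ∈ S, ¬ (y v k <+: y w l ∨ y w l <+: y v k) := by
  by_contra! hbad
  let U : Ultrafilter ℕ := Filter.hyperfilter ℕ
  have hcof : (U : Filter ℕ) ≤ Filter.cofinite := Filter.hyperfilter_le_cofinite
  have pigeon : ∀ p : ℕ → ι → ι → Prop, (∀ᶠ l in (U : Filter ℕ), ∃ v ∈ S, ∃ w ∈ S, p l v w) →
      ∃ v ∈ S, ∃ w ∈ S, ∀ᶠ l in (U : Filter ℕ), p l v w := by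
    intro p hp
    have h1 : (⋃ v ∈ S, {l | ∃ w ∈ S, p l v w}) ∈ U := by
      filter_upwards [hp] with l hl
      simpa using hl
    obtain ⟨v, hv, h2⟩ := (Ultrafilter.finite_biUnion_mem_iff hS).1 h1
    have h3 : (⋃ w ∈ S, {l | p l v w}) ∈ U := by
      filter_upwards [h2] with l hl
      simpa using hl
    obtain ⟨w, hw, h4⟩ := (Ultrafilter.finite_biUnion_mem_iff hS).1 h3
    exact ⟨v, hv, w, hw, h4⟩
  have h1 : ∀ k, ∃ v ∈ S, ∃ w ∈ S, ∀ᶠ l in (U : Filter ℕ),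
      y v k <+: y w l ∨ y w l <+: y v k := by
    intro k
    refine pigeon (fun l v w => y v k <+: y w l ∨ y w l <+: y v k) ?_
    have : ∀ᶠ l in (U : Filter ℕ), l ∉ Set.Iic k := hcof (Set.finite_Iic k).compl_mem_cofinite
    filter_upwards [this] with l hl
    exact hbad k l (by simpa using hl)
  have h2 : ∀ k, ∃ v ∈ S, ∃ w ∈ S, ∀ᶠ l in (U : Filter ℕ), y v k <+: y w l := by
    intro k
    obtain ⟨v, hv, w, hw, h⟩ := h1 k
    refine ⟨v, hv, w, hw, ?_⟩
    have hf : ((fun l => (y w l).length) ⁻¹' Set.Iic (y v k).length).Finite :=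
      (Set.finite_Iic _).preimage (hinj w hw).injOn
    filter_upwards [h, hcof hf.compl_mem_cofinite] with l hl hlen
    have hlen : (y v k).length < (y w l).length := by simpa using hlen
    rcases hl with hl | hl
    · exact hl
    · exact absurd hl.length_le (by omega)
  obtain ⟨v, hv, w, -, h3⟩ := pigeon (fun k v w => ∀ᶠ l in (U : Filter ℕ), y v k <+: y w l)
    (Filter.Eventually.of_forall h2)
  let K : Set ℕ := {k | ∀ᶠ l in (U : Filter ℕ), y v k <+: y w l}
  have hKinf : K.Infinite := fun hfin =>
    (Filter.notMem_hyperfilter_of_finite hfin) h3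
  have hfin : (y v '' K).Finite := by
    refine List.finite_of_pairwise_comparable _ ?_ ?_
    · rintro _ ⟨k, -, rfl⟩
      exact hy v hv k
    · rintro _ ⟨k, hk, rfl⟩ _ ⟨k', hk', rfl⟩
      obtain ⟨l, hl, hl'⟩ := (Filter.Eventually.and hk hk').exists
      exact List.prefix_or_prefix_of_prefix hl hl'
  refine hKinf (hfin.of_finite_image fun a _ b _ hab => hinj v hv ?_)
  simp only [hab]

theorem SimpleGraph.adj_iterate {V : Type*} {H : SimpleGraph V} {g : V → V}
    (hg : ∀ u v, H.Adj u v → H.Adj (g u) (g v)) (n : ℕ) {u v : V} (h : H.Adj u v) :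
    H.Adj (g^[n] u) (g^[n] v) := by
  induction n with
  | zero => exact h
  | succ n ih => simpa only [Function.iterate_succ_apply'] using hg _ _ ih

/-- Under iteration of a self-map, a point has infinite orbit or is eventually periodic. -/
theorem Function.iterate_injective_or_eventually_periodic {V : Type*} (g : V → V) (s : V) :
    (Function.Injective fun i => g^[i] s) ∨
      ∃ q, 0 < q ∧ ∃ a, ∀ i ≥ a, Function.IsPeriodicPt g q (g^[i] s) := by
  by_cases hinj : Function.Injective fun i => g^[i] s
  · exact Or.inl hinj
  right
  have key : ∀ m n, m < n → g^[m] s = g^[n] s →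
      ∃ q, 0 < q ∧ ∃ a, ∀ i ≥ a, Function.IsPeriodicPt g q (g^[i] s) := by
    intro m n hmn heq
    refine ⟨n - m, by omega, m, fun i hi => ?_⟩
    have h0 : Function.IsPeriodicPt g (n - m) (g^[m] s) := by
      change g^[n - m] (g^[m] s) = g^[m] s
      rw [← Function.iterate_add_apply, Nat.sub_add_cancel hmn.le, heq]
    have := h0.apply_iterate (i - m)
    rwa [← Function.iterate_add_apply, Nat.sub_add_cancel hi] at this
  simp only [Function.Injective, not_forall] at hinj
  obtain ⟨m, n, heq, hne⟩ := hinj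
  rcases lt_or_gt_of_ne hne with h | h
  · exact key m n h heq
  · exact key n m h heq.symm

/-- Along the iterates of an endomorphism, the adjacencies between the images of finitely many
vertices stabilize, and those vertices with finite orbit become periodic with a common period. -/
theorem SimpleGraph.exists_stable_iterate {V : Type*} {H : SimpleGraph V} {g : V → V}
    (hg : ∀ u v, H.Adj u v → H.Adj (g u) (g v)) {S : Set V} (hS : S.Finite) :
    ∃ a q, a < q ∧
      (∀ s ∈ S, (Function.Injective fun i => g^[i] s) ∨
        ∀ i ≥ a, Function.IsPeriodicPt g q (g^[i] s)) ∧
      ∀ s ∈ S, ∀ t ∈ S, ∀ i, H.Adj (g^[i] s) (g^[i] t) →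
        ∀ j ≥ a, H.Adj (g^[j] s) (g^[j] t) := by
  classical
  have hadj : ∀ s t : V, ∀ᶠ a in Filter.atTop, ∀ i, H.Adj (g^[i] s) (g^[i] t) →
      ∀ j ≥ a, H.Adj (g^[j] s) (g^[j] t) := by
    intro s t
    by_cases h : ∃ i, H.Adj (g^[i] s) (g^[i] t)
    · obtain ⟨i, hi⟩ := h
      filter_upwards [Filter.eventually_ge_atTop i] with a ha _ _ j hj
      have := SimpleGraph.adj_iterate hg (j - i) hi
      rwa [← Function.iterate_add_apply, ← Function.iterate_add_apply,
        Nat.sub_add_cancel (ha.trans hj)] at this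
    · exact Filter.Eventually.of_forall fun a i hi => absurd ⟨i, hi⟩ h
  have hper : ∀ s : V, ∃ q, 0 < q ∧ ∀ᶠ a in Filter.atTop,
      (Function.Injective fun i => g^[i] s) ∨ ∀ i ≥ a, Function.IsPeriodicPt g q (g^[i] s) := by
    intro s
    rcases Function.iterate_injective_or_eventually_periodic g s with h | ⟨q, hq, a, h⟩
    · exact ⟨1, one_pos, Filter.Eventually.of_forall fun _ => Or.inl h⟩
    · refine ⟨q, hq, ?_⟩
      filter_upwards [Filter.eventually_ge_atTop a] with b hb
      exact Or.inr fun i hi => h i (hb.trans hi)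
  choose q hq hqper using hper
  have hA := (hS.eventually_all (l := Filter.atTop)).2 fun s _ =>
    (hS.eventually_all (l := Filter.atTop)).2 fun t _ => hadj s t
  have hP := (hS.eventually_all (l := Filter.atTop)).2 fun s _ => hqper s
  obtain ⟨a, hA, hP⟩ := (hA.and hP).exists
  refine ⟨a, (a + 1) * ∏ s ∈ hS.toFinset, q s, ?_, fun s hs => ?_, hA⟩
  · have : 0 < ∏ s ∈ hS.toFinset, q s := Finset.prod_pos fun s _ => hq s
    nlinarith
  · refine (hP s hs).imp_right fun h i hi => (h i hi).trans_dvd ?_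
    exact (Finset.dvd_prod_of_mem q (hS.mem_toFinset.2 hs)).mul_left _

/-- If `F` sends the vertices of `H` to strictly decreasing lists over a well-founded order,
adjacent vertices to comparable lists, and taking lengths gives an endomorphism `g` of `H`, then
any set of vertices with finite image under `g` can be enlarged by a finite set onto which the
enlarged set retracts. -/
theorem SimpleGraph.exists_finite_retract {β : Type*} [Preorder β] [WellFoundedLT β]
    {H : SimpleGraph ℕ} (F : ℕ → List β) (hF : ∀ v, (F v).IsChain (· > ·))
    (hcomp : ∀ u v, H.Adj u v → F u <+: F v ∨ F v <+: F u)
    (hlen : ∀ u v, H.Adj u v → H.Adj (F u).length (F v).length)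
    {C : Set ℕ} (hC : ((fun v => (F v).length) '' C).Finite) :
    ∃ P : Set ℕ, P.Finite ∧ ∃ ψ : ℕ → ℕ, (∀ v ∈ C ∪ P, ψ v ∈ P) ∧
      ∀ u ∈ C ∪ P, ∀ v ∈ C ∪ P, H.Adj u v → H.Adj (ψ u) (ψ v) := by
  classical
  let g : ℕ → ℕ := fun v => (F v).length
  let S : Set ℕ := g '' C
  obtain ⟨a, q, haq, hper, hadj⟩ := SimpleGraph.exists_stable_iterate (g := g) hlen hC
  obtain ⟨k, l, hkl, hnot⟩ := List.exists_lt_incomparable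
    (S := {s ∈ S | Function.Injective fun i => g^[i] s}) (hC.subset (Set.sep_subset _ _))
    (fun s k => F (g^[q * (k + 1)] s)) (fun _ _ _ => hF _) (by
      rintro s ⟨-, hs⟩ i j hij
      have hij : g (g^[q * (i + 1)] s) = g (g^[q * (j + 1)] s) := hij
      rw [← Function.iterate_succ_apply' g, ← Function.iterate_succ_apply' g] at hij
      have h2 : q * (i + 1) = q * (j + 1) := Nat.succ_injective (hs hij)
      have h3 := Nat.eq_of_mul_eq_mul_left (by omega) h2
      omega)
  obtain ⟨d, rfl⟩ : ∃ d, l = k + (d + 1) := ⟨l - k - 1, by omega⟩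
  obtain ⟨p, hp⟩ : ∃ p, q * (d + 1) = p + 1 := ⟨q * (d + 1) - 1, by
    have : 0 < q * (d + 1) := Nat.mul_pos (by omega) (by omega)
    omega⟩
  have hpa : a ≤ p := by nlinarith
  have hexp : q * (k + (d + 1) + 1) = q * (k + 1) + 1 + p := by
    rw [show k + (d + 1) + 1 = (k + 1) + (d + 1) by ring, mul_add, hp]; ring
  have hka : a ≤ q * (k + 1) := by nlinarith
  have hfix : ∀ s ∈ S, ¬ (Function.Injective fun i => g^[i] s) →
      g^[q * (k + (d + 1) + 1)] s = g^[q * (k + 1)] s := by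
    intro s hs hinj
    have h := ((hper s hs).resolve_left hinj _ hka).mul_const (d + 1)
    have h : g^[q * (d + 1)] (g^[q * (k + 1)] s) = g^[q * (k + 1)] s := h
    rw [← Function.iterate_add_apply] at h
    rw [← h]
    congr 2
    ring
  have cross : ∀ x ∈ C, ∀ t ∈ S, H.Adj x (g^[p] t) → H.Adj (g^[p] (g x)) (g^[p] t) := by
    intro x hx t ht h
    have hs : g x ∈ S := ⟨x, hx, rfl⟩
    have h1 := SimpleGraph.adj_iterate (g := g) hlen (q * (k + 1) + 1) h
    rw [← Function.iterate_add_apply, ← hexp, Function.iterate_succ_apply] at h1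
    by_cases hsi : Function.Injective fun i => g^[i] (g x)
    · by_cases hti : Function.Injective fun i => g^[i] t
      · exact absurd (hcomp _ _ h1) (hnot _ ⟨hs, hsi⟩ _ ⟨ht, hti⟩)
      · rw [hfix t ht hti] at h1
        exact hadj _ hs _ ht _ h1 p hpa
    · rw [← hfix _ hs hsi] at h1
      exact hadj _ hs _ ht _ h1 p hpa
  refine ⟨g^[p] '' S, hC.image _, fun v => if v ∈ g^[p] '' S then v else g^[p] (g v), ?_, ?_⟩
  · rintro v (hv | hv)
    · by_cases h : v ∈ g^[p] '' S
      · simpa only [if_pos h] using h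
      · simpa only [if_neg h] using ⟨g v, ⟨v, hv, rfl⟩, rfl⟩
    · simpa only [if_pos hv] using hv
  · intro u hu v hv huv
    by_cases h1 : u ∈ g^[p] '' S <;> by_cases h2 : v ∈ g^[p] '' S
    · simpa only [if_pos h1, if_pos h2] using huv
    · simp only [if_pos h1, if_neg h2]
      obtain ⟨t, ht, rfl⟩ := h1
      exact (cross v (hv.resolve_right h2) t ht huv.symm).symm
    · simp only [if_neg h1, if_pos h2]
      obtain ⟨t, ht, rfl⟩ := h2
      exact cross u (hu.resolve_right h1) t ht huv
    · simp only [if_neg h1, if_neg h2]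
      exact SimpleGraph.adj_iterate (g := g) hlen p (hlen _ _ huv)

theorem GTree_adj_length {H : SimpleGraph ℕ} {α : Ordinal} {ν μ : DecSeq α}
    (h : (GTree H α).Adj ν μ) : H.Adj ν.1.length μ.1.length := by
  rcases ((SimpleGraph.fromRel_adj _ _ _).1 h).2 with h | h
  · exact h.2
  · exact h.2.symm

theorem GTree_prefix_of_adj {H : SimpleGraph ℕ} {α : Ordinal} {ν μ : DecSeq α}
    (h : (GTree H α).Adj ν μ) : ν.1 <+: μ.1 ∨ μ.1 <+: ν.1 :=
  ((SimpleGraph.fromRel_adj _ _ _).1 h).2.imp And.left And.left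

theorem hasFiniteCore_of_finite_range {W : Type*} {H : SimpleGraph W} (g : H →g H)
    (hg : (Set.range g).Finite) : HasFiniteCore H :=
  ⟨(⊤ : H.Subgraph).induce (Set.range g), hg,
    ⟨⟨fun v => ⟨g v, v, rfl⟩, fun {u v} h => by simpa using g.map_adj h⟩⟩,
    ⟨SimpleGraph.Subgraph.hom _⟩⟩

theorem exists_finite_homEquiv_of_retract {W : Type*} {H : SimpleGraph W} {C P : Set W}
    (hPC : P ⊆ C) (hP : P.Finite) (ψ : W → W) (hψ : ∀ v ∈ C, ψ v ∈ P)
    (hadj : ∀ u ∈ C, ∀ v ∈ C, H.Adj u v → H.Adj (ψ u) (ψ v)) :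
    ∃ H' : H.Subgraph, H'.verts.Finite ∧ HomEquiv (H.induce C) H'.coe :=
  ⟨(⊤ : H.Subgraph).induce P, hP,
    ⟨⟨fun v => ⟨ψ v, hψ v v.2⟩, fun {u v} h => by
      simpa [hψ u u.2, hψ v v.2] using hadj u u.2 v v.2 h⟩⟩,
    ⟨⟨fun v => ⟨v, hPC v.2⟩, fun {u v} h =>
      ((⊤ : H.Subgraph).induce P).adj_sub h⟩⟩⟩

/-- If adjacent vertices have comparable labels, then a walk starting at a label extending
`ν ++ [b]` and avoiding the vertices labelled by prefixes of `ν` stays above `ν ++ [b]`. -/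
theorem SimpleGraph.Walk.prefix_of_avoids {V β : Type*} {H : SimpleGraph V} {F : V → List β}
    (hcomp : ∀ u v, H.Adj u v → F u <+: F v ∨ F v <+: F u) {ν : List β} {b : β}
    {x y : V} (p : H.Walk x y) (hp : ∀ v ∈ p.support, ¬ F v <+: ν) (hx : ν ++ [b] <+: F x) :
    ν ++ [b] <+: F y := by
  induction p with
  | nil => exact hx
  | @cons u v w h p ih =>
    refine ih (fun z hz => hp z (by simp [hz])) ?_
    rcases hcomp _ _ h with h1 | h1
    · exact hx.trans h1
    · rcases List.prefix_or_prefix_of_prefix hx h1 with h2 | h2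
      · exact h2
      · rcases List.prefix_concat_iff.1 h2 with h3 | h3
        · exact h3 ▸ List.prefix_rfl
        · exact absurd h3 (hp v (by simp))

theorem not_nonempty_hom_GTree_of_HConnected {H : SimpleGraph ℕ} (hconn : HConnected H H)
    (hcore : ¬ HasFiniteCore H) (α : Ordinal) : ¬ Nonempty (H →g GTree H α) := by
  rintro ⟨f⟩
  let F : ℕ → List Ordinal := fun v => (f v).1
  have hF : ∀ v, (F v).IsChain (· > ·) := fun v => (f v).2.1
  have hcomp : ∀ u v, H.Adj u v → F u <+: F v ∨ F v <+: F u := fun u v h =>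
    GTree_prefix_of_adj (f.map_adj h)
  have hlen : ∀ u v, H.Adj u v → H.Adj (F u).length (F v).length := fun u v h =>
    GTree_adj_length (f.map_adj h)
  have hinf : ¬ (Set.range F).Finite := by
    intro hfin
    refine hcore (hasFiniteCore_of_finite_range ⟨fun v => (F v).length, fun {u v} => hlen u v⟩ ?_)
    refine (hfin.image List.length).subset ?_
    rintro _ ⟨v, rfl⟩
    exact ⟨F v, ⟨v, rfl⟩, rfl⟩
  obtain ⟨ν, hν⟩ : ∃ ν : List Ordinal, {b | ∃ y ∈ Set.range F, ν ++ [b] <+: y}.Infinite := by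
    by_contra! h
    refine hinf (List.finite_of_finite_extensions _ ?_ fun ν => by simpa using h ν)
    rintro _ ⟨v, rfl⟩
    exact hF v
  have hex : ∀ b ∈ {b | ∃ y ∈ Set.range F, ν ++ [b] <+: y}, ∃ x, ν ++ [b] <+: F x := by
    rintro b ⟨_, ⟨x, rfl⟩, hx⟩
    exact ⟨x, hx⟩
  choose! x hx using hex
  have huniq : ∀ b c : Ordinal, ∀ v, ν ++ [b] <+: F v → ν ++ [c] <+: F v → b = c := by
    intro b c v hb hc
    simpa using (List.prefix_of_prefix_length_le hb hc (by simp)).eq_of_length (by simp)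
  have havoid : ∀ b v, ν ++ [b] <+: F v → ¬ F v <+: ν := by
    intro b v hb h
    have := (hb.trans h).length_le
    simp at this
  obtain ⟨P, hP, ψ, hψ, hψadj⟩ := SimpleGraph.exists_finite_retract F hF hcomp hlen
    (C := {v | F v <+: ν}) ((Set.finite_Iic ν.length).subset (by
      rintro _ ⟨v, hv, rfl⟩
      exact List.IsPrefix.length_le hv))
  refine hconn ⟨x '' {b | ∃ y ∈ Set.range F, ν ++ [b] <+: y}, {v | F v <+: ν} ∪ P,
    hν.image fun b hb c hc hbc => huniq b c (x b) (hx b hb) (hbc ▸ hx c hc), ?_,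
    exists_finite_homEquiv_of_retract Set.subset_union_right hP ψ hψ hψadj⟩
  rintro _ ⟨b, hb, rfl⟩ _ ⟨c, hc, rfl⟩ hne ⟨p, hp⟩
  refine hne (congrArg x (huniq b c _ (p.prefix_of_avoids hcomp ?_ (hx b hb)) (hx c hc)))
  intro v hv
  rcases hp v hv with h | rfl | rfl
  · exact fun h' => h (Or.inl h')
  · exact havoid b _ (hx b hb)
  · exact havoid c _ (hx c hc)

/-- If `H` (countable, on `ℕ`) is `H`-connected and has no finite core, then
for every countable ordinal `α` there is no homomorphism `H → H^{<α>}`;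
since also `H^{<α>} → H` always holds, `H^{<α>} < H`. -/
theorem GTree_strictly_below_of_HConnected (H : SimpleGraph ℕ)
    (hconn : HConnected H H) (hcore : ¬ HasFiniteCore H) :
    ∀ α : Ordinal, α.card ≤ Cardinal.aleph0 →
      ¬ Nonempty (H →g GTree H α) ∧ Nonempty (GTree H α →g H) := by
  exact fun α _ => ⟨not_nonempty_hom_GTree_of_HConnected hconn hcore α,
    ⟨⟨fun ν => ν.1.length, fun h => GTree_adj_length h⟩⟩⟩
end
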